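/- arXiv:1705.05042 — 6 statements merged into one kernel-verified Lean document; each statement's English description precedes it below -/
import Mathlib

section
/- Let (R, m) be a commutative Noetherian local ring, let I be an m-primary ideal of R, let l > 0 be an integer, and let x ∈ I \ I² be a nonzerodivisor of R. Assume that for every 1 ≤ i ≤ l the R/I-module I^i/I^{i+1} is free and the map I^{i-1}/I^i → I^i/I^{i+1} induced by multiplication by x is injective (with the convention I^0 = R). Then x·I^i = (x) ∩ I^{i+1} for all 0 ≤ i ≤ l. -/
/-- Lemma 2.3(1) of the paper.
Let `(R, m)` be a commutative Noetherian local ring, `I` an `m`-primary ideal,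
`l > 0`, and `x ∈ I \ I²` a nonzerodivisor of `R`.  Assume that for every
`1 ≤ i ≤ l` the `R/I`-module `Iⁱ/Iⁱ⁺¹` is free and the map
`Iⁱ⁻¹/Iⁱ → Iⁱ/Iⁱ⁺¹` induced by multiplication by `x` is injective
(elementwise: `a ∈ Iⁱ⁻¹` with `x·a ∈ Iⁱ⁺¹` implies `a ∈ Iⁱ`).
Then `x·Iⁱ = (x) ∩ Iⁱ⁺¹` for all `0 ≤ i ≤ l`. -/
theorem stmt0 {R : Type*} [CommRing R] [IsNoetherianRing R] [IsLocalRing R]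
    (I : Ideal R) (hprim : I.radical = IsLocalRing.maximalIdeal R)
    (l : ℕ) (hl : 0 < l)
    (x : R) (hxI : x ∈ I) (hxI2 : x ∉ I ^ 2) (hx : x ∈ nonZeroDivisors R)
    (hfree : ∀ i : ℕ, 1 ≤ i → i ≤ l →
      Module.Free (R ⧸ I) (↥(I ^ i) ⧸ (I • ⊤ : Submodule R ↥(I ^ i))))
    (hinj : ∀ i : ℕ, 1 ≤ i → i ≤ l →
      ∀ a ∈ I ^ (i - 1), x * a ∈ I ^ (i + 1) → a ∈ I ^ i) :
    ∀ i : ℕ, i ≤ l → Ideal.span {x} * I ^ i = Ideal.span {x} ⊓ I ^ (i + 1) := by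
  have colon : ∀ i : ℕ, i ≤ l → ∀ a : R, x * a ∈ I ^ (i + 1) → a ∈ I ^ i := by
    intro i
    induction i with
    | zero => simp
    | succ k ih =>
      intro hk a ha
      exact hinj (k + 1) (Nat.succ_pos k) hk a
        (ih (Nat.le_of_succ_le hk) a (Ideal.pow_le_pow_right (Nat.le_succ _) ha)) ha
  intro i hi
  ext y
  rw [Ideal.mem_span_singleton_mul, Ideal.mem_inf, Ideal.mem_span_singleton]
  constructor
  · rintro ⟨a, ha, rfl⟩
    exact ⟨dvd_mul_right x a, pow_succ' I i ▸ Ideal.mul_mem_mul hxI ha⟩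
  · rintro ⟨⟨a, rfl⟩, ha⟩
    exact ⟨a, colon i hi a ha, rfl⟩
end

section
/- Let (R, m) be a commutative Noetherian local ring, let I be an m-primary ideal of R, let l > 0 be an integer, and let x ∈ I \ I² be a nonzerodivisor of R. Assume that for every 1 ≤ i ≤ l the R/I-module I^i/I^{i+1} is free and the map I^{i-1}/I^i → I^i/I^{i+1} induced by multiplication by x is injective (with the convention I^0 = R). Then for every 1 ≤ i ≤ l there is an isomorphism of R/I-modules I^i/I^{i+1} ≅ (I^{i-1}/I^i) ⊕ I^i/(xI^{i-1} + I^{i+1}). -/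
/-- The quotient `Iⁱ/(x·Iⁱ⁻¹ + Iⁱ⁺¹)` is annihilated by `I`, hence is an
`R/I`-module. -/
noncomputable instance quotByXPowModule {R : Type*} [CommRing R] (I : Ideal R) (x : R)
    (i : ℕ) :
    Module (R ⧸ I)
      (↥(I ^ i) ⧸ (Submodule.comap (I ^ i).subtype
        (Ideal.span {x} * I ^ (i - 1) ⊔ I ^ (i + 1)))) :=
  Module.IsTorsionBySet.module <| (Module.isTorsionBySet_quotient_iff _ _).mpr
    fun m r hr => by
      have hm : r * (m : R) ∈ I ^ (i + 1) := by
        rw [pow_succ']; exact Ideal.mul_mem_mul hr m.2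
      simpa [Submodule.mem_comap, Submodule.subtype_apply, smul_eq_mul] using
        Ideal.mem_sup_right hm

open TensorProduct in
/-- Over a local ring of depth zero, an injective linear map between finite free modules is a
split injection. -/
theorem IsLocalRing.exists_leftInverse_of_injective_of_maximalIdeal_mem_associatedPrimes
    {A M N : Type*} [CommRing A] [IsNoetherianRing A] [IsLocalRing A]
    [AddCommGroup M] [AddCommGroup N] [Module A M] [Module A N]
    [Module.Free A M] [Module.Free A N] [Module.Finite A M] [Module.Finite A N]
    (h : maximalIdeal A ∈ associatedPrimes A A)
    (f : M →ₗ[A] N) (hf : Function.Injective f) :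
    ∃ g : N →ₗ[A] M, g ∘ₗ f = LinearMap.id := by
  rw [split_injective_iff_lTensor_residueField_injective]
  obtain ⟨-, s, hs⟩ := isAssociatedPrime_iff.mp h
  have hker : LinearMap.ker (LinearMap.toSpanSingleton A A s) = maximalIdeal A := by
    ext a
    rw [hs]
    simp [Submodule.mem_colon_singleton]
  let σ : ResidueField A →ₗ[A] A :=
    (maximalIdeal A).liftQ (LinearMap.toSpanSingleton A A s) hker.ge
  have hσ : Function.Injective σ := by
    rw [← LinearMap.ker_eq_bot]
    exact Submodule.ker_liftQ_eq_bot _ _ _ hker.le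
  have hcomm : f.lTensor A ∘ₗ σ.rTensor M = σ.rTensor N ∘ₗ f.lTensor (ResidueField A) := by
    rw [LinearMap.lTensor_comp_rTensor, LinearMap.rTensor_comp_lTensor]
  have hinj : Function.Injective (f.lTensor A ∘ₗ σ.rTensor M) :=
    (Module.Flat.lTensor_preserves_injective_linearMap f hf).comp
      (Module.Flat.rTensor_preserves_injective_linearMap σ hσ)
  rw [hcomm, LinearMap.coe_comp] at hinj
  exact hinj.of_comp

/-- If the radical of `I` is the maximal ideal of a Noetherian local ring `R`, then `R ⧸ I` has
depth zero. -/
theorem IsLocalRing.maximalIdeal_quotient_mem_associatedPrimes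
    {R : Type*} [CommRing R] [IsNoetherianRing R] [IsLocalRing R] {I : Ideal R}
    [IsLocalRing (R ⧸ I)] (hI : I.radical = maximalIdeal R) :
    maximalIdeal (R ⧸ I) ∈ associatedPrimes (R ⧸ I) (R ⧸ I) := by
  obtain ⟨P, hP⟩ := associatedPrimes.nonempty (R ⧸ I) (R ⧸ I)
  have hPprime : P.IsPrime := hP.1
  suffices maximalIdeal (R ⧸ I) = P from this ▸ hP
  refine le_antisymm (fun a ha => ?_) (le_maximalIdeal hPprime.ne_top)
  obtain ⟨r, rfl⟩ := Ideal.Quotient.mk_surjective a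
  have hr : r ∈ I.radical := by
    rw [hI, mem_maximalIdeal, mem_nonunits_iff]
    exact fun hu => ha (hu.map _)
  obtain ⟨n, hn⟩ := hr
  refine hPprime.mem_of_pow_mem n ?_
  rw [← map_pow, Ideal.Quotient.eq_zero_iff_mem.mpr hn]
  exact P.zero_mem

theorem Ideal.mem_smul_top_pow_iff {R : Type*} [CommRing R] {I : Ideal R} {n : ℕ} {a : ↥(I ^ n)} :
    a ∈ (I • ⊤ : Submodule R ↥(I ^ n)) ↔ (a : R) ∈ I ^ (n + 1) := by
  rw [Submodule.mem_smul_top_iff, smul_eq_mul, pow_succ']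

/-- Multiplication by `x ∈ I` as a linear map from `I ^ n` to `I ^ (n + 1)`. -/
def Ideal.mulPow {R : Type*} [CommRing R] {I : Ideal R} {x : R} (hx : x ∈ I) (n : ℕ) :
    ↥(I ^ n) →ₗ[R] ↥(I ^ (n + 1)) :=
  (LinearMap.mulLeft R x).restrict fun a ha => by
    rw [pow_succ']
    exact Ideal.mul_mem_mul hx ha

/-- The `R ⧸ I`-linear map `I ^ n / I ^ (n + 1) → I ^ (n + 1) / I ^ (n + 2)` induced by
multiplication by `x ∈ I`. -/
def Ideal.mulPowQuotient {R : Type*} [CommRing R] {I : Ideal R} {x : R} (hx : x ∈ I) (n : ℕ) :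
    (↥(I ^ n) ⧸ (I • ⊤ : Submodule R ↥(I ^ n))) →ₗ[R ⧸ I]
      (↥(I ^ (n + 1)) ⧸ (I • ⊤ : Submodule R ↥(I ^ (n + 1)))) where
  __ := Submodule.mapQ _ _ (Ideal.mulPow hx n) <| by
    rw [← Submodule.map_le_iff_le_comap, Submodule.map_smul'']
    exact Submodule.smul_mono le_rfl le_top
  map_smul' := by
    rintro ⟨r⟩ m
    exact (Submodule.mapQ _ _ (Ideal.mulPow hx n) _).map_smul r m

/-- The projection `I ^ n / I ^ (n + 1) → I ^ n / (x I ^ (n - 1) + I ^ (n + 1))` as an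
`R ⧸ I`-linear map. -/
noncomputable def Ideal.powQuotientProj {R : Type*} [CommRing R] (I : Ideal R) (x : R) (n : ℕ) :
    (↥(I ^ n) ⧸ (I • ⊤ : Submodule R ↥(I ^ n))) →ₗ[R ⧸ I]
      (↥(I ^ n) ⧸ (Submodule.comap (I ^ n).subtype
        (Ideal.span {x} * I ^ (n - 1) ⊔ I ^ (n + 1)))) where
  __ := Submodule.factor (p := (I • ⊤ : Submodule R ↥(I ^ n)))
    (p' := Submodule.comap (I ^ n).subtype (Ideal.span {x} * I ^ (n - 1) ⊔ I ^ (n + 1)))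
    fun _ ha => Ideal.mem_sup_right (Ideal.mem_smul_top_pow_iff.mp ha)
  map_smul' := by
    rintro ⟨r⟩ ⟨m⟩
    rfl

theorem Ideal.powQuotientProj_surjective {R : Type*} [CommRing R] (I : Ideal R) (x : R) (n : ℕ) :
    Function.Surjective (Ideal.powQuotientProj I x n) := by
  rintro ⟨m⟩
  exact ⟨Submodule.Quotient.mk m, rfl⟩

theorem Ideal.mulPowQuotient_injective {R : Type*} [CommRing R] {I : Ideal R} {x : R}
    (hx : x ∈ I) {n : ℕ} (h : ∀ a ∈ I ^ n, x * a ∈ I ^ (n + 2) → a ∈ I ^ (n + 1)) :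
    Function.Injective (Ideal.mulPowQuotient hx n) := by
  rw [injective_iff_map_eq_zero]
  rintro ⟨a⟩ ha
  have hxa : Ideal.mulPow hx n a ∈ (I • ⊤ : Submodule R ↥(I ^ (n + 1))) :=
    (Submodule.Quotient.mk_eq_zero _).mp ha
  exact (Submodule.Quotient.mk_eq_zero _).mpr <| Ideal.mem_smul_top_pow_iff.mpr <|
    h a a.2 (Ideal.mem_smul_top_pow_iff.mp hxa)

theorem Ideal.exact_mulPowQuotient_powQuotientProj {R : Type*} [CommRing R] {I : Ideal R} {x : R}
    (hx : x ∈ I) (n : ℕ) :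
    Function.Exact (Ideal.mulPowQuotient hx n) (Ideal.powQuotientProj I x (n + 1)) := by
  rintro ⟨b⟩
  constructor
  · intro hb
    have hb' : (b : R) ∈ Ideal.span {x} * I ^ n ⊔ I ^ (n + 2) :=
      (Submodule.Quotient.mk_eq_zero
        (Submodule.comap (I ^ (n + 1)).subtype (Ideal.span {x} * I ^ n ⊔ I ^ (n + 2)))).mp hb
    obtain ⟨y, hy, z, hz, hyz⟩ := Submodule.mem_sup.mp hb'
    obtain ⟨a, ha, rfl⟩ := Ideal.mem_span_singleton_mul.mp hy
    refine ⟨Submodule.Quotient.mk ⟨a, ha⟩, (Submodule.Quotient.eq _).mpr ?_⟩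
    rw [Ideal.mem_smul_top_pow_iff]
    have hab : x * a - (b : R) = -z := by rw [← hyz]; ring
    change x * a - (b : R) ∈ I ^ (n + 2)
    exact hab ▸ neg_mem hz
  · rintro ⟨⟨a⟩, ha⟩
    rw [← ha]
    exact (Submodule.Quotient.mk_eq_zero _).mpr <| Ideal.mem_sup_left <|
      Ideal.mul_mem_mul (Ideal.mem_span_singleton_self x) a.2

theorem Ideal.free_quotient_smul_top_pow_zero {R : Type*} [CommRing R] (I : Ideal R) :
    Module.Free (R ⧸ I) (↥(I ^ 0) ⧸ (I • ⊤ : Submodule R ↥(I ^ 0))) := by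
  let e : (↥(I ^ 0) ⧸ (I • ⊤ : Submodule R ↥(I ^ 0))) ≃ₗ[R] R ⧸ I :=
    Submodule.Quotient.equiv _ _
      ((LinearEquiv.ofEq _ _ (by simp)).trans Submodule.topEquiv) (by
        rw [Submodule.map_smul'', Submodule.map_top, LinearEquiv.range, smul_eq_mul,
          Ideal.mul_top])
  let e' : (↥(I ^ 0) ⧸ (I • ⊤ : Submodule R ↥(I ^ 0))) ≃ₗ[R ⧸ I] R ⧸ I :=
    { e with
      map_smul' := by
        rintro ⟨r⟩ m
        exact e.map_smul r m }
  exact Module.Free.of_equiv e'.symm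

instance Ideal.finite_quotient_smul_top_pow {R : Type*} [CommRing R] [IsNoetherianRing R]
    (I : Ideal R) (n : ℕ) :
    Module.Finite (R ⧸ I) (↥(I ^ n) ⧸ (I • ⊤ : Submodule R ↥(I ^ n))) := by
  have : IsScalarTower R (R ⧸ I) (↥(I ^ n) ⧸ (I • ⊤ : Submodule R ↥(I ^ n))) :=
    (Module.isTorsionBySet_quotient_ideal_smul _ I).isScalarTower
  exact Module.Finite.of_restrictScalars_finite R _ _

/-- Lemma 2.3(2) of the paper.
Let `(R, m)` be a commutative Noetherian local ring, `I` an `m`-primary ideal,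
`l > 0`, and `x ∈ I \ I²` a nonzerodivisor of `R`.  Assume that for every
`1 ≤ i ≤ l` the `R/I`-module `Iⁱ/Iⁱ⁺¹` is free and the map
`Iⁱ⁻¹/Iⁱ → Iⁱ/Iⁱ⁺¹` induced by multiplication by `x` is injective
(elementwise: `a ∈ Iⁱ⁻¹` with `x·a ∈ Iⁱ⁺¹` implies `a ∈ Iⁱ`).
Then for every `1 ≤ i ≤ l` there is an isomorphism of `R/I`-modules
`Iⁱ/Iⁱ⁺¹ ≅ (Iⁱ⁻¹/Iⁱ) ⊕ Iⁱ/(x·Iⁱ⁻¹ + Iⁱ⁺¹)`. -/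
theorem stmt1 {R : Type*} [CommRing R] [IsNoetherianRing R] [IsLocalRing R]
    (I : Ideal R) (hprim : I.radical = IsLocalRing.maximalIdeal R)
    (l : ℕ) (hl : 0 < l)
    (x : R) (hxI : x ∈ I) (hxI2 : x ∉ I ^ 2) (hx : x ∈ nonZeroDivisors R)
    (hfree : ∀ i : ℕ, 1 ≤ i → i ≤ l →
      Module.Free (R ⧸ I) (↥(I ^ i) ⧸ (I • ⊤ : Submodule R ↥(I ^ i))))
    (hinj : ∀ i : ℕ, 1 ≤ i → i ≤ l →
      ∀ a ∈ I ^ (i - 1), x * a ∈ I ^ (i + 1) → a ∈ I ^ i) :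
    ∀ i : ℕ, 1 ≤ i → i ≤ l →
      Nonempty
        ((↥(I ^ i) ⧸ (I • ⊤ : Submodule R ↥(I ^ i))) ≃ₗ[R ⧸ I]
          ((↥(I ^ (i - 1)) ⧸ (I • ⊤ : Submodule R ↥(I ^ (i - 1)))) ×
            (↥(I ^ i) ⧸ (Submodule.comap (I ^ i).subtype
              (Ideal.span {x} * I ^ (i - 1) ⊔ I ^ (i + 1)))))) := by
  rintro (_ | n) hi hil
  · omega
  have hI : I ≠ ⊤ := by
    rintro rfl
    exact IsLocalRing.maximalIdeal.isMaximal R |>.ne_top (by rw [← hprim, Ideal.radical_top])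
  have : Nontrivial (R ⧸ I) := Ideal.Quotient.nontrivial_iff.mpr hI
  have : IsLocalRing (R ⧸ I) :=
    IsLocalRing.of_surjective' (Ideal.Quotient.mk I) Ideal.Quotient.mk_surjective
  have : Module.Free (R ⧸ I) (↥(I ^ n) ⧸ (I • ⊤ : Submodule R ↥(I ^ n))) := by
    rcases n with _ | n
    · exact Ideal.free_quotient_smul_top_pow_zero I
    · exact hfree (n + 1) (by omega) (by omega)
  have := hfree (n + 1) hi hil
  obtain ⟨g, hg⟩ :=
    IsLocalRing.exists_leftInverse_of_injective_of_maximalIdeal_mem_associatedPrimes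
      (IsLocalRing.maximalIdeal_quotient_mem_associatedPrimes hprim)
      (Ideal.mulPowQuotient hxI n) (Ideal.mulPowQuotient_injective hxI (hinj (n + 1) hi hil))
  exact ⟨((Ideal.exact_mulPowQuotient_powQuotientProj hxI n).splitInjectiveEquiv
    (Ideal.powQuotientProj_surjective I x (n + 1)) ⟨g, hg⟩).1⟩
end

section
/- Let (R, m) be a commutative Noetherian local ring, let I be an m-primary ideal of R, let l > 0 be an integer, and let x ∈ I \ I² be a nonzerodivisor of R. Assume that for every 1 ≤ i ≤ l the R/I-module I^i/I^{i+1} is free and the map I^{i-1}/I^i → I^i/I^{i+1} induced by multiplication by x is injective (with the convention I^0 = R). Then for every 1 ≤ i ≤ l there is an isomorphism of R-modules (I^i + (x))/xI^i ≅ (R/I^i) ⊕ (I^i/xI^{i-1}). -/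
/-- Over a local ring whose maximal ideal is killed by a nonzero element, an injective linear map
between finite free modules splits. -/
theorem IsLocalRing.exists_leftInverse_of_injective_of_smul_maximalIdeal {A F G : Type*}
    [CommRing A] [IsLocalRing A] [AddCommGroup F] [Module A F] [AddCommGroup G] [Module A G]
    [Module.Finite A F] [Module.Free A F] [Module.Finite A G] [Module.Free A G]
    (s : A) (hs : s ≠ 0) (hsm : ∀ a ∈ IsLocalRing.maximalIdeal A, s * a = 0)
    (f : F →ₗ[A] G) (hf : Function.Injective f) : ∃ g, g ∘ₗ f = LinearMap.id := by
  rw [IsLocalRing.split_injective_iff_lTensor_residueField_injective, injective_iff_map_eq_zero]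
  intro t ht
  obtain ⟨v, rfl⟩ := TensorProduct.mk_surjective A F (IsLocalRing.ResidueField A)
    IsLocalRing.residue_surjective t
  have key : ∀ w : G, w ∈ IsLocalRing.maximalIdeal A • (⊤ : Submodule A G) → s • w = 0 := by
    intro w hw
    refine Submodule.smul_induction_on hw ?_ ?_
    · intro a ha n _
      rw [smul_smul, hsm a ha, zero_smul]
    · intro y z hy hz
      rw [smul_add, hy, hz, add_zero]
  have hfv : f v ∈ IsLocalRing.maximalIdeal A • (⊤ : Submodule A G) := by
    rw [← LinearMap.ker_tensorProductMk]
    exact ht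
  have hsv : s • v = 0 := hf (by rw [map_smul, key _ hfv, map_zero])
  suffices v ∈ IsLocalRing.maximalIdeal A • (⊤ : Submodule A F) by
    rw [← LinearMap.ker_tensorProductMk] at this
    exact this
  let b := Module.Free.chooseBasis A F
  rw [← b.sum_repr v]
  refine sum_mem fun i _ => Submodule.smul_mem_smul ?_ trivial
  rw [IsLocalRing.mem_maximalIdeal, mem_nonunits_iff]
  intro hu
  have : s * b.repr v i = 0 := by
    simpa using congrArg (fun w => b.repr w i) hsv
  exact hs (hu.mul_left_eq_zero.mp this)

/-- A nontrivial quotient of a Noetherian ring has a nonzero element killed by the nilradical. -/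
theorem Ideal.exists_notMem_forall_mem_radical_mul_mem {R : Type*} [CommRing R]
    [IsNoetherianRing R] (I : Ideal R) (hI : I ≠ ⊤) :
    ∃ s, s ∉ I ∧ ∀ a ∈ I.radical, s * a ∈ I := by
  classical
  have hex := I.exists_radical_pow_le_of_fg I.radical.fg_of_isNoetherianRing
  have hpos : Nat.find hex ≠ 0 := by
    intro h0
    have := Nat.find_spec hex
    rw [h0, pow_zero, Ideal.one_eq_top, top_le_iff] at this
    exact hI this
  have hlt : Nat.find hex - 1 < Nat.find hex := by omega
  obtain ⟨s, hs, hsI⟩ := SetLike.not_le_iff_exists.mp (Nat.find_min hex hlt)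
  refine ⟨s, hsI, fun a ha => Nat.find_spec hex ?_⟩
  have := Ideal.mul_mem_mul hs ha
  rwa [← pow_succ, Nat.sub_add_cancel (by omega)] at this

/-- If `M / I M` and `N / I N` are free over `R / I`, with `I` primary to the maximal ideal, and
`f : M → N` is injective modulo `I`, then the image of `f` has a complement modulo `I`. -/
theorem LinearMap.exists_complement_range_modulo {R M N : Type*} [CommRing R] [IsNoetherianRing R]
    [IsLocalRing R] (I : Ideal R) (hprim : I.radical = IsLocalRing.maximalIdeal R)
    [AddCommGroup M] [Module R M] [AddCommGroup N] [Module R N]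
    [Module.Finite R M] [Module.Finite R N]
    (hM : Module.Free (R ⧸ I) (M ⧸ (I • ⊤ : Submodule R M)))
    (hN : Module.Free (R ⧸ I) (N ⧸ (I • ⊤ : Submodule R N)))
    (f : M →ₗ[R] N)
    (hf : ∀ m, f m ∈ (I • ⊤ : Submodule R N) → m ∈ (I • ⊤ : Submodule R M)) :
    ∃ J : Submodule R N, I • ⊤ ≤ J ∧ J ⊔ LinearMap.range f = ⊤ ∧
      J ⊓ LinearMap.range f ≤ I • ⊤ := by
  have hI : I ≠ ⊤ := by
    rintro rfl
    rw [Ideal.radical_top] at hprim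
    exact (IsLocalRing.maximalIdeal.isMaximal R).ne_top hprim.symm
  have : Nontrivial (R ⧸ I) := Ideal.Quotient.nontrivial_iff.mpr hI
  have : IsLocalRing (R ⧸ I) :=
    IsLocalRing.of_surjective' (Ideal.Quotient.mk I) Ideal.Quotient.mk_surjective
  have : Module.Finite (R ⧸ I) (M ⧸ (I • ⊤ : Submodule R M)) :=
    Module.Finite.of_restrictScalars_finite R _ _
  have : Module.Finite (R ⧸ I) (N ⧸ (I • ⊤ : Submodule R N)) :=
    Module.Finite.of_restrictScalars_finite R _ _
  obtain ⟨s, hsI, hs⟩ := I.exists_notMem_forall_mem_radical_mul_mem hI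
  have hinj : Function.Injective (f.reduceModIdeal I) := by
    rw [injective_iff_map_eq_zero]
    intro q hq
    obtain ⟨m, rfl⟩ := Submodule.Quotient.mk_surjective _ q
    rw [LinearMap.reduceModIdeal_apply, Submodule.Quotient.mk_eq_zero] at hq
    exact (Submodule.Quotient.mk_eq_zero _).mpr (hf m hq)
  obtain ⟨g, hg⟩ := IsLocalRing.exists_leftInverse_of_injective_of_smul_maximalIdeal
    (Ideal.Quotient.mk I s) (by rwa [Ne, Ideal.Quotient.eq_zero_iff_mem])
    (by
      intro a ha
      obtain ⟨a, rfl⟩ := Ideal.Quotient.mk_surjective a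
      rw [← map_mul, Ideal.Quotient.eq_zero_iff_mem]
      refine hs a ?_
      rw [hprim]
      rw [IsLocalRing.mem_maximalIdeal, mem_nonunits_iff] at ha ⊢
      exact fun h => ha (h.map _))
    (f.reduceModIdeal I) hinj
  have hgf (m : M) : g (Submodule.Quotient.mk (f m)) = Submodule.Quotient.mk m := by
    simpa using LinearMap.congr_fun hg (Submodule.Quotient.mk m)
  have mem (n : N) : n ∈ LinearMap.ker ((g.restrictScalars R) ∘ₗ
      (I • ⊤ : Submodule R N).mkQ) ↔ g (Submodule.Quotient.mk n) = 0 := Iff.rfl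
  refine ⟨LinearMap.ker ((g.restrictScalars R) ∘ₗ (I • ⊤ : Submodule R N).mkQ), ?_, ?_, ?_⟩
  · intro n hn
    rw [mem, (Submodule.Quotient.mk_eq_zero _).mpr hn, map_zero]
  · rw [eq_top_iff]
    intro n _
    obtain ⟨m, hm⟩ := Submodule.Quotient.mk_surjective _ (g (Submodule.Quotient.mk n))
    rw [← sub_add_cancel n (f m)]
    refine Submodule.add_mem_sup ?_ (LinearMap.mem_range_self f m)
    rw [mem, Submodule.Quotient.mk_sub, map_sub, hgf, hm, sub_self]
  · rintro _ ⟨h, m, rfl⟩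
    rw [SetLike.mem_coe, mem, hgf, Submodule.Quotient.mk_eq_zero] at h
    have := Submodule.mem_map_of_mem (f := f) h
    rw [Submodule.map_smul''] at this
    exact Submodule.smul_mono le_rfl le_top this

/-- Two surjective linear maps with the same kernel have isomorphic codomains. -/
theorem LinearMap.nonempty_linearEquiv_of_ker_eq {R L M N : Type*} [Ring R]
    [AddCommGroup L] [Module R L] [AddCommGroup M] [Module R M] [AddCommGroup N] [Module R N]
    (f : L →ₗ[R] M) (g : L →ₗ[R] N) (hf : Function.Surjective f) (hg : Function.Surjective g)
    (h : LinearMap.ker f = LinearMap.ker g) : Nonempty (M ≃ₗ[R] N) :=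
  ⟨(f.quotKerEquivOfSurjective hf).symm ≪≫ₗ Submodule.quotEquivOfEq _ _ h ≪≫ₗ
    g.quotKerEquivOfSurjective hg⟩

/-- If multiplication by `x` is injective on each `Iʲ⁻¹ / Iʲ` with `1 ≤ j ≤ l`, then
`x a ∈ Iⁱ⁺¹` forces `a ∈ Iⁱ` for `i ≤ l`. -/
theorem Ideal.mem_pow_of_mul_mem_pow_succ {R : Type*} [CommRing R] (I : Ideal R) (l : ℕ) (x : R)
    (hinj : ∀ i : ℕ, 1 ≤ i → i ≤ l → ∀ a ∈ I ^ (i - 1), x * a ∈ I ^ (i + 1) → a ∈ I ^ i)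
    (i : ℕ) (hi : i ≤ l) (a : R) (ha : x * a ∈ I ^ (i + 1)) : a ∈ I ^ i := by
  induction i with
  | zero => simp
  | succ i ih =>
    exact hinj (i + 1) (by omega) hi a
      (ih (by omega) (Ideal.pow_le_pow_right (by omega) ha)) ha

/-- If `J + x P = Q` and `J ∩ (x) = x Q`, then `(Q + (x)) / x Q` is isomorphic to
`R / Q ⊕ Q / x P`: both are quotients of `R × J` by the same submodule. -/
theorem Ideal.nonempty_linearEquiv_sup_span_quotient {R : Type*} [CommRing R] (P Q : Ideal R)
    (x : R) (J : Ideal R) (hJQ : J ≤ Q)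
    (hsup : J ⊔ Ideal.span {x} * P = Q) (hinf : ∀ a, x * a ∈ J ↔ a ∈ Q) (hQP : Q ≤ P) :
    Nonempty ((↥(Q ⊔ Ideal.span {x}) ⧸
        Submodule.comap (Q ⊔ Ideal.span {x}).subtype (Ideal.span {x} * Q)) ≃ₗ[R]
      ((R ⧸ Q) × (↥Q ⧸ Submodule.comap Q.subtype (Ideal.span {x} * P)))) := by
  have hmem : x ∈ Q ⊔ Ideal.span {x} := Ideal.mem_sup_right (Ideal.mem_span_singleton_self x)
  let f : (R × J) →ₗ[R] ↥(Q ⊔ Ideal.span {x}) :=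
    (LinearMap.toSpanSingleton R _ ⟨x, hmem⟩).coprod (Submodule.inclusion (hJQ.trans le_sup_left))
  have hf (r : R) (j : J) : (f (r, j) : R) = r * x + j := rfl
  refine LinearMap.nonempty_linearEquiv_of_ker_eq (L := R × J) (Submodule.mkQ _ ∘ₗ f)
    ((Submodule.mkQ _).prodMap (Submodule.mkQ _ ∘ₗ Submodule.inclusion hJQ)) ?_ ?_ ?_
  · refine (Submodule.mkQ_surjective _).comp ?_
    rintro ⟨y, hy⟩
    obtain ⟨q, hq, z, hz, rfl⟩ := Submodule.mem_sup.mp hy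
    obtain ⟨r, rfl⟩ := Ideal.mem_span_singleton'.mp hz
    rw [← hsup] at hq
    obtain ⟨j, hj, w, hw, rfl⟩ := Submodule.mem_sup.mp hq
    obtain ⟨p, -, rfl⟩ := Ideal.mem_span_singleton_mul.mp hw
    refine ⟨(p + r, ⟨j, hj⟩), Subtype.ext ?_⟩
    rw [hf]
    ring
  · rw [LinearMap.coe_prodMap]
    refine Function.Surjective.prodMap (Submodule.mkQ_surjective Q) ?_
    intro q
    obtain ⟨⟨q, hq⟩, rfl⟩ := Submodule.Quotient.mk_surjective _ q
    obtain ⟨j, hj, w, hw, rfl⟩ := Submodule.mem_sup.mp (hsup.ge hq)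
    refine ⟨⟨j, hj⟩, (Submodule.Quotient.eq _).mpr ?_⟩
    simpa using hw
  · ext ⟨r, j, hj⟩
    have h1 : (r, (⟨j, hj⟩ : J)) ∈ LinearMap.ker (Submodule.mkQ
        (Submodule.comap (Q ⊔ Ideal.span {x}).subtype (Ideal.span {x} * Q)) ∘ₗ f) ↔
        r * x + j ∈ Ideal.span {x} * Q := by
      rw [LinearMap.mem_ker, LinearMap.comp_apply, Submodule.mkQ_apply,
        Submodule.Quotient.mk_eq_zero]
      rfl
    have h2 : (r, (⟨j, hj⟩ : J)) ∈ LinearMap.ker ((Submodule.mkQ Q).prodMap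
        (Submodule.mkQ (Submodule.comap Q.subtype (Ideal.span {x} * P)) ∘ₗ
          Submodule.inclusion hJQ)) ↔ r ∈ Q ∧ j ∈ Ideal.span {x} * P := by
      rw [LinearMap.mem_ker, LinearMap.prodMap_apply, Prod.mk_eq_zero, LinearMap.comp_apply,
        Submodule.mkQ_apply, Submodule.mkQ_apply, Submodule.Quotient.mk_eq_zero,
        Submodule.Quotient.mk_eq_zero]
      rfl
    rw [h1, h2]
    constructor
    · intro h
      obtain ⟨q, hq, hqj⟩ := Ideal.mem_span_singleton_mul.mp h
      have hj' : j = x * (q - r) := by linear_combination -hqj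
      have hqr : q - r ∈ Q := (hinf _).mp (hj' ▸ hj)
      exact ⟨by simpa using sub_mem hq hqr,
        Ideal.mem_span_singleton_mul.mpr ⟨_, hQP hqr, hj'.symm⟩⟩
    · rintro ⟨hr, h⟩
      obtain ⟨p, -, rfl⟩ := Ideal.mem_span_singleton_mul.mp h
      exact Ideal.mem_span_singleton_mul.mpr ⟨r + p, add_mem hr ((hinf p).mp hj), by ring⟩

/-- Lemma 2.3(4) of the paper.
Let `(R, m)` be a commutative Noetherian local ring, `I` an `m`-primary ideal,
`l > 0`, and `x ∈ I \ I²` a nonzerodivisor of `R`.  Assume that for every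
`1 ≤ i ≤ l` the `R/I`-module `Iⁱ/Iⁱ⁺¹` is free and the map
`Iⁱ⁻¹/Iⁱ → Iⁱ/Iⁱ⁺¹` induced by multiplication by `x` is injective
(elementwise: `a ∈ Iⁱ⁻¹` with `x·a ∈ Iⁱ⁺¹` implies `a ∈ Iⁱ`).
Then for every `1 ≤ i ≤ l` there is an isomorphism of `R`-modules
`(Iⁱ + (x))/x·Iⁱ ≅ (R/Iⁱ) ⊕ (Iⁱ/x·Iⁱ⁻¹)`. -/
theorem stmt3 {R : Type*} [CommRing R] [IsNoetherianRing R] [IsLocalRing R]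
    (I : Ideal R) (hprim : I.radical = IsLocalRing.maximalIdeal R)
    (l : ℕ) (hl : 0 < l)
    (x : R) (hxI : x ∈ I) (hxI2 : x ∉ I ^ 2) (hx : x ∈ nonZeroDivisors R)
    (hfree : ∀ i : ℕ, 1 ≤ i → i ≤ l →
      Module.Free (R ⧸ I) (↥(I ^ i) ⧸ (I • ⊤ : Submodule R ↥(I ^ i))))
    (hinj : ∀ i : ℕ, 1 ≤ i → i ≤ l →
      ∀ a ∈ I ^ (i - 1), x * a ∈ I ^ (i + 1) → a ∈ I ^ i) :
    ∀ i : ℕ, 1 ≤ i → i ≤ l →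
      Nonempty
        ((↥(I ^ i ⊔ Ideal.span {x}) ⧸
            Submodule.comap (I ^ i ⊔ Ideal.span {x}).subtype
              (Ideal.span {x} * I ^ i)) ≃ₗ[R]
          ((R ⧸ I ^ i) ×
            (↥(I ^ i) ⧸ Submodule.comap (I ^ i).subtype
              (Ideal.span {x} * I ^ (i - 1))))) := by
  intro i hi hil
  have hmem := I.mem_pow_of_mul_mem_pow_succ l x hinj
  have hsmul (j : ℕ) (y : ↥(I ^ j)) :
      y ∈ (I • ⊤ : Submodule R ↥(I ^ j)) ↔ (y : R) ∈ I ^ (j + 1) := by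
    rw [Submodule.mem_smul_top_iff, pow_succ', smul_eq_mul]
  have hfree' : Module.Free (R ⧸ I)
      (↥(I ^ (i - 1)) ⧸ (I • ⊤ : Submodule R ↥(I ^ (i - 1)))) := by
    obtain rfl | hi1 := hi.eq_or_lt
    · rw [Nat.sub_self]
      have hsurj : Function.Surjective (Algebra.linearMap R (R ⧸ I) ∘ₗ (I ^ 0).subtype) := by
        intro q
        obtain ⟨r, rfl⟩ := Ideal.Quotient.mk_surjective q
        exact ⟨⟨r, by simp⟩, rfl⟩
      have hker : (I • ⊤ : Submodule R ↥(I ^ 0)) =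
          LinearMap.ker (Algebra.linearMap R (R ⧸ I) ∘ₗ (I ^ 0).subtype) := by
        ext y
        rw [hsmul, zero_add, pow_one]
        exact Ideal.Quotient.eq_zero_iff_mem.symm
      let e := Submodule.quotEquivOfEq _ _ hker ≪≫ₗ LinearMap.quotKerEquivOfSurjective _ hsurj
      exact Module.Free.of_equiv
        (e.extendScalarsOfSurjective Ideal.Quotient.mk_surjective).symm
    · exact hfree (i - 1) (by omega) (by omega)
  have hmul (a : R) (ha : a ∈ I ^ (i - 1)) : x * a ∈ I ^ i := by
    have := Ideal.mul_mem_mul hxI ha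
    rwa [← pow_succ', Nat.sub_add_cancel hi] at this
  let f : ↥(I ^ (i - 1)) →ₗ[R] ↥(I ^ i) := (LinearMap.mulLeft R x).restrict hmul
  have hf (a : ↥(I ^ (i - 1))) : (f a : R) = x * a := rfl
  obtain ⟨J, hJ, hsup, hinf⟩ := f.exists_complement_range_modulo I hprim hfree' (hfree i hi hil)
    (by
      intro a ha
      rw [hsmul] at ha ⊢
      rw [Nat.sub_add_cancel hi]
      exact hmem i hil _ ha)
  have hrange : (LinearMap.range f).map (I ^ i).subtype = Ideal.span {x} * I ^ (i - 1) := by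
    ext y
    rw [Ideal.mem_span_singleton_mul]
    constructor
    · rintro ⟨_, ⟨a, rfl⟩, rfl⟩
      exact ⟨a, a.2, rfl⟩
    · rintro ⟨a, ha, rfl⟩
      exact ⟨_, ⟨⟨a, ha⟩, rfl⟩, rfl⟩
  refine Ideal.nonempty_linearEquiv_sup_span_quotient _ _ x (J.map (I ^ i).subtype)
    (Submodule.map_subtype_le _ _) ?_ ?_ (Ideal.pow_le_pow_right (Nat.sub_le _ _))
  · rw [← hrange, ← Submodule.map_sup, hsup, Submodule.map_subtype_top]
  · intro a
    constructor
    · rintro ⟨y, hy, hya⟩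
      have hya : (y : R) = x * a := hya
      have ha : a ∈ I ^ (i - 1) := by
        refine hmem (i - 1) (by omega) a ?_
        rw [Nat.sub_add_cancel hi, ← hya]
        exact y.2
      have hya' : y = f ⟨a, ha⟩ := Subtype.ext hya
      have := (hsmul i y).mp (hinf ⟨hy, _, hya'.symm⟩)
      exact hmem i hil a (hya ▸ this)
    · intro ha
      have hxa : x * a ∈ I ^ (i + 1) := by
        rw [pow_succ']
        exact Ideal.mul_mem_mul hxI ha
      exact ⟨⟨x * a, Ideal.pow_le_pow_right (Nat.le_succ i) hxa⟩, hJ ((hsmul i _).mpr hxa), rfl⟩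
end

section
/- Let (R, m) be a commutative Noetherian local ring of Krull dimension d ≥ 1, and let I be an m-primary ideal of R. Suppose there exist elements x₁, …, x_d ∈ I forming a regular sequence on R such that, with Q = (x₁, …, x_d), one has I² = QI, and suppose that I/I² is a free R/I-module. Then for every integer l ≥ 1 the R/I-module I^l/I^{l+1} is free. -/
open MvPolynomial

theorem Ideal.mem_span_image_pow_mul_iff {σ R : Type*} [CommRing R] (x : σ → R) (s : Set σ)
    (n : ℕ) (J : Ideal R) (y : R) :
    y ∈ Ideal.span (x '' s) ^ n * J ↔ ∃ F : MvPolynomial σ R, F.IsHomogeneous n ∧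
      F ∈ supported R s ∧ F ∈ J.map (C : R →+* MvPolynomial σ R) ∧ eval x F = y := by
  constructor
  · intro hy
    refine Submodule.mul_induction_on hy ?_ ?_
    · intro a ha b hb
      rw [Set.image_eq_range, Ideal.mem_span_pow_iff_exists_isHomogeneous] at ha
      obtain ⟨p, hp, rfl⟩ := ha
      refine ⟨C b * rename Subtype.val p, ?_, ?_, ?_, ?_⟩
      · simpa using (isHomogeneous_C σ b).mul (hp.rename_isHomogeneous (f := Subtype.val))
      · refine mul_mem (Subalgebra.algebraMap_mem _ b) ?_
        rw [supported_eq_range_rename]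
        exact ⟨p, rfl⟩
      · exact Ideal.mul_mem_right _ _ (Ideal.mem_map_of_mem _ hb)
      · simp [eval_rename, mul_comm, Function.comp_def]
    · rintro a b ⟨F, hF, hFs, hFJ, rfl⟩ ⟨G, hG, hGs, hGJ, rfl⟩
      exact ⟨F + G, hF.add hG, add_mem hFs hGs, add_mem hFJ hGJ, map_add _ _ _⟩
  · rintro ⟨F, hF, hFs, hFJ, rfl⟩
    rw [eval_eq]
    refine Ideal.sum_mem _ fun m hm ↦ ?_
    rw [mul_comm (coeff m F)]
    refine Ideal.mul_mem_mul ?_ (MvPolynomial.mem_map_C_iff.1 hFJ m)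
    have hdeg := hF (mem_support_iff.1 hm)
    have hms : ∀ i ∈ m.support, i ∈ s := fun i hi ↦
      mem_supported.1 hFs ((mem_vars_iff_mem_support i).2 ⟨m, hm, hi⟩)
    have : n = ∑ i ∈ m.support, m i := by
      rw [← hdeg, Finsupp.weight_apply, Finsupp.sum]; simp
    rw [this, ← Finset.prod_pow_eq_pow_sum]
    exact Ideal.prod_mem_prod fun i hi ↦
      Ideal.pow_mem_pow (Ideal.subset_span (Set.mem_image_of_mem x (hms i hi))) _

/-- The elements `x i`, `i ∈ s`, are quasi-regular: a form in them that vanishes has all its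
coefficients in the ideal they generate. -/
def IsQuasiRegularOn {σ R : Type*} [CommRing R] (x : σ → R) (s : Set σ) : Prop :=
  ∀ (n : ℕ) (F : MvPolynomial σ R), F.IsHomogeneous n → F ∈ supported R s → eval x F = 0 →
    F ∈ (Ideal.span (x '' s)).map (C : R →+* MvPolynomial σ R)

namespace IsQuasiRegularOn

variable {σ R : Type*} [CommRing R] {x : σ → R} {s : Set σ}

/-- If a form of degree `n` takes a value in `Q ^ n * J`, then its coefficients lie in `Q + J`. -/
theorem mem_map_C_of_eval_mem (h : IsQuasiRegularOn x s) {J : Ideal R}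
    (hJ : Ideal.span (x '' s) ≤ J) {n : ℕ} {F : MvPolynomial σ R} (hF : F.IsHomogeneous n)
    (hFs : F ∈ supported R s) (hev : eval x F ∈ Ideal.span (x '' s) ^ n * J) :
    F ∈ J.map (C : R →+* MvPolynomial σ R) := by
  obtain ⟨G, hG, hGs, hGJ, hGF⟩ := (Ideal.mem_span_image_pow_mul_iff ..).1 hev
  have := h n (F - G) (hF.sub hG) (sub_mem hFs hGs) (by simp [hGF])
  simpa using add_mem (Ideal.map_mono hJ this) hGJ

theorem mem_pow_of_mul_mem (h : IsQuasiRegularOn x s) {a : R}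
    (ha : ∀ r, a * r ∈ Ideal.span (x '' s) → r ∈ Ideal.span (x '' s)) (n : ℕ) {r : R}
    (hr : a * r ∈ Ideal.span (x '' s) ^ n) : r ∈ Ideal.span (x '' s) ^ n := by
  induction n with
  | zero => simp
  | succ n ih =>
    have hrn := ih (Ideal.pow_le_pow_right n.le_succ hr)
    rw [← Ideal.mul_top (_ ^ n), Ideal.mem_span_image_pow_mul_iff] at hrn
    obtain ⟨F, hF, hFs, -, rfl⟩ := hrn
    rw [pow_succ] at hr ⊢
    refine (Ideal.mem_span_image_pow_mul_iff ..).2 ⟨F, hF, hFs, ?_, rfl⟩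
    have := h.mem_map_C_of_eval_mem (F := C a * F) le_rfl
      (by simpa using (isHomogeneous_C σ a).mul hF)
      (mul_mem (Subalgebra.algebraMap_mem _ a) hFs) (by simpa using hr)
    rw [MvPolynomial.mem_map_C_iff] at this ⊢
    exact fun m ↦ ha _ (by simpa using this m)

theorem insert (h : IsQuasiRegularOn x s) {k : σ}
    (hk : ∀ r, x k * r ∈ Ideal.span (x '' s) → r ∈ Ideal.span (x '' s)) :
    IsQuasiRegularOn x (insert k s) := by
  classical
  have hle : Ideal.span (x '' s) ≤ Ideal.span (x '' Insert.insert k s) :=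
    Ideal.span_mono (Set.image_mono (Set.subset_insert k s))
  intro n
  induction n with
  | zero =>
    intro F hF _ hev
    rw [← totalDegree_zero_iff_isHomogeneous, totalDegree_eq_zero_iff_eq_C] at hF
    rw [hF, eval_C] at hev
    rw [hF, hev]
    simp
  | succ n ih =>
    intro F hF hFs hev
    have hvar : ∀ m ∈ F.support, ∀ i ∈ m.support, i = k ∨ i ∈ s := fun m hm i hi ↦
      mem_supported.1 hFs ((mem_vars_iff_mem_support i).2 ⟨m, hm, hi⟩)
    set H := divMonomial F (Finsupp.single k 1) with hHdef
    set G := modMonomial F (Finsupp.single k 1) with hGdef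
    have hFGH : X k * H + G = F := divMonomial_add_modMonomial_single F k
    have hH : H.IsHomogeneous n := by
      intro m hm
      rw [coeff_divMonomial] at hm
      have := hF hm
      rw [map_add, Finsupp.weight_single] at this
      simp at this
      omega
    have hHs : H ∈ supported R (Insert.insert k s) := by
      rw [mem_supported]
      intro i hi
      obtain ⟨m, hm, hmi⟩ := (mem_vars_iff_mem_support i).1 hi
      refine hvar (Finsupp.single k 1 + m) (by simpa [mem_support_iff, hHdef] using hm) i ?_
      simp at hmi ⊢
      omega
    have hGc : ∀ m, coeff m G ≠ 0 → coeff m F ≠ 0 ∧ m k = 0 := by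
      intro m hm
      by_cases hmk : Finsupp.single k 1 ≤ m
      · exact absurd (coeff_modMonomial_of_le F hmk) hm
      · rw [hGdef, coeff_modMonomial_of_not_le F hmk] at hm
        simp at hmk
        exact ⟨hm, hmk⟩
    have hG : G.IsHomogeneous (n + 1) := fun m hm ↦ hF (hGc m hm).1
    have hGs : G ∈ supported R s := by
      rw [mem_supported]
      intro i hi
      obtain ⟨m, hm, hmi⟩ := (mem_vars_iff_mem_support i).1 hi
      obtain ⟨hmF, hmk⟩ := hGc m (mem_support_iff.1 hm)
      refine (hvar m (mem_support_iff.2 hmF) i hmi).resolve_left ?_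
      rintro rfl
      simp [hmk] at hmi
    have hevs : x k * eval x H + eval x G = 0 := by
      rw [← hFGH] at hev
      simpa using hev
    have hHpow : eval x H ∈ Ideal.span (x '' s) ^ (n + 1) := by
      refine h.mem_pow_of_mul_mem hk _ ?_
      rw [eq_neg_of_add_eq_zero_left hevs, neg_mem_iff, ← Ideal.mul_top (_ ^ (n + 1)),
        Ideal.mem_span_image_pow_mul_iff]
      exact ⟨G, hG, hGs, by simp [Ideal.map_top], rfl⟩
    have hHmem : H ∈ (Ideal.span (x '' Insert.insert k s)).map (C : R →+* MvPolynomial σ R) := by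
      have hH' := Ideal.pow_right_mono hle _ hHpow
      rw [pow_succ, Ideal.mem_span_image_pow_mul_iff] at hH'
      obtain ⟨L, hL, hLs, hLC, hLH⟩ := hH'
      simpa using add_mem (ih (H - L) (hH.sub hL) (sub_mem hHs hLs) (by simp [hLH])) hLC
    have hGmem : G ∈ (Ideal.span (x '' Insert.insert k s)).map (C : R →+* MvPolynomial σ R) := by
      rw [← Ideal.mul_top (_ ^ (n + 1)), Ideal.mem_span_image_pow_mul_iff] at hHpow
      obtain ⟨L, hL, hLs, -, hLH⟩ := hHpow
      have := h (n + 1) (G + C (x k) * L)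
        (hG.add (by simpa using (isHomogeneous_C σ (x k)).mul hL))
        (add_mem hGs (mul_mem (Subalgebra.algebraMap_mem _ (x k)) hLs))
        (by simpa [hLH, add_comm] using hevs)
      have hL' : C (x k) * L ∈ (Ideal.span (x '' Insert.insert k s)).map C :=
        Ideal.mul_mem_right _ _ (Ideal.mem_map_of_mem _
          (Ideal.subset_span ⟨k, Set.mem_insert k s, rfl⟩))
      simpa using sub_mem (Ideal.map_mono hle this) hL'
    rw [← hFGH]
    exact add_mem (Ideal.mul_mem_left _ _ hHmem) hGmem

end IsQuasiRegularOn

theorem RingTheory.Sequence.IsWeaklyRegular.isQuasiRegularOn {R : Type*} [CommRing R] {d : ℕ}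
    {x : Fin d → R} (h : RingTheory.Sequence.IsWeaklyRegular R (List.ofFn x)) :
    IsQuasiRegularOn x Set.univ := by
  have key : ∀ k ≤ d, IsQuasiRegularOn x {i | (i : ℕ) < k} := by
    intro k
    induction k with
    | zero =>
      intro _ n F _ hFs hev
      simp only [Nat.not_lt_zero, Set.ofPred_false, supported_empty] at hFs
      obtain ⟨r, rfl⟩ := Algebra.mem_bot.1 hFs
      have : r = 0 := by simpa [algebraMap_eq] using hev
      simp [this]
    | succ k ih =>
      intro hk
      have hset : {i : Fin d | (i : ℕ) < k + 1} = insert ⟨k, hk⟩ {i : Fin d | (i : ℕ) < k} := by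
        ext i
        simp [Fin.ext_iff]
        omega
      rw [hset]
      refine (ih (by omega)).insert fun r hr ↦ ?_
      have hreg := h.regular_mod_prev k (by simpa using hk)
      rw [isSMulRegular_quotient_iff_mem_of_smul_mem] at hreg
      have hspan : Ideal.ofList ((List.ofFn x).take k)
          = Ideal.span (x '' {i : Fin d | (i : ℕ) < k}) := by
        refine congrArg Ideal.span (Set.ext fun y ↦ ?_)
        rw [Set.mem_ofPred_eq, List.mem_take_iff_getElem, Set.mem_image]
        constructor
        · rintro ⟨i, hi, rfl⟩
          have hik := lt_min_iff.1 hi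
          rw [List.length_ofFn] at hik
          exact ⟨⟨i, hik.2⟩, hik.1, by simp⟩
        · rintro ⟨i, hi, rfl⟩
          exact ⟨i, by simpa using hi, by simp⟩
      simpa [hspan, hr] using hreg r
  have := key d le_rfl
  rwa [show {i : Fin d | (i : ℕ) < d} = Set.univ by ext i; simp] at this

theorem Module.Free.quotient_smul_top {R P : Type*} [CommRing R] [AddCommGroup P] [Module R P]
    [Module.Free R P] (I : Ideal R) : Module.Free (R ⧸ I) (P ⧸ (I • ⊤ : Submodule R P)) :=
  Module.Free.of_equiv ((TensorProduct.quotTensorEquivQuotSMul P I).extendScalarsOfSurjective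
    Ideal.Quotient.mk_surjective)

theorem Module.Free.quotient_smul_top_of_surjective {R P M : Type*} [CommRing R] [AddCommGroup P]
    [Module R P] [Module.Free R P] [AddCommGroup M] [Module R M] (I : Ideal R) (f : P →ₗ[R] M)
    (hf : Function.Surjective f)
    (hI : ∀ p, f p ∈ (I • ⊤ : Submodule R M) → p ∈ (I • ⊤ : Submodule R P)) :
    Module.Free (R ⧸ I) (M ⧸ (I • ⊤ : Submodule R M)) := by
  have := Module.Free.quotient_smul_top (P := P) I
  let g := Submodule.mapQ _ _ f (Submodule.smul_top_le_comap_smul_top I f)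
  have hg : Function.Bijective g := by
    constructor
    · rw [injective_iff_map_eq_zero]
      intro p hp
      obtain ⟨p, rfl⟩ := Submodule.Quotient.mk_surjective _ p
      rw [Submodule.mapQ_apply, Submodule.Quotient.mk_eq_zero] at hp
      exact (Submodule.Quotient.mk_eq_zero _).2 (hI p hp)
    · intro m
      obtain ⟨m, rfl⟩ := Submodule.Quotient.mk_surjective _ m
      obtain ⟨p, rfl⟩ := hf m
      exact ⟨Submodule.Quotient.mk p, rfl⟩
  exact Module.Free.of_equiv ((LinearEquiv.ofBijective g hg).extendScalarsOfSurjective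
    (S := R ⧸ I) Ideal.Quotient.mk_surjective)

instance MvPolynomial.free_homogeneousSubmodule {σ R : Type*} [CommRing R] (n : ℕ) :
    Module.Free R (homogeneousSubmodule σ R n) := by
  rw [homogeneousSubmodule_eq_finsupp_supported]
  exact Module.Free.of_equiv (AddMonoidAlgebra.supportedEquivFinsupp _).symm

theorem MvPolynomial.mem_smul_top_homogeneousSubmodule {σ R : Type*} [CommRing R] {n : ℕ}
    {I : Ideal R} (F : homogeneousSubmodule σ R n)
    (hF : (F : MvPolynomial σ R) ∈ I.map (C : R →+* MvPolynomial σ R)) :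
    F ∈ (I • ⊤ : Submodule R (homogeneousSubmodule σ R n)) := by
  have hdeg : ∀ m ∈ (F : MvPolynomial σ R).support,
      monomial m (1 : R) ∈ homogeneousSubmodule σ R n := fun m hm ↦
    isHomogeneous_monomial _ (by
      have := F.2 (mem_support_iff.1 hm)
      rwa [Finsupp.degree_eq_weight_one])
  have : F = ∑ m ∈ (F : MvPolynomial σ R).support.attach,
      coeff m.1 (F : MvPolynomial σ R) • (⟨_, hdeg m.1 m.2⟩ : homogeneousSubmodule σ R n) := by
    apply Subtype.ext
    rw [AddSubmonoidClass.coe_finsetSum]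
    conv_lhs => rw [(F : MvPolynomial σ R).as_sum, ← Finset.sum_attach]
    simp [smul_monomial]
  rw [this]
  exact sum_mem fun m _ ↦ Submodule.smul_mem_smul (MvPolynomial.mem_map_C_iff.1 hF _) trivial

/-- Over a local ring with a nonzero element killed by the maximal ideal, the cokernel of an
injection between finite free modules is free. -/
theorem Module.Free.quotient_range_of_injective {A M N : Type*} [CommRing A] [IsLocalRing A]
    [AddCommGroup M] [Module A M] [AddCommGroup N] [Module A N] [Module.Finite A M]
    [Module.Free A M] [Module.Finite A N] [Module.Free A N] {s : A} (hs : s ≠ 0)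
    (hsm : ∀ a ∈ IsLocalRing.maximalIdeal A, s * a = 0) (f : M →ₗ[A] N)
    (hf : Function.Injective f) : Module.Free A (N ⧸ LinearMap.range f) := by
  refine Module.free_of_lTensor_residueField_injective f (LinearMap.range f).mkQ
    (Submodule.mkQ_surjective _) f.exact_map_mkQ_range ?_
  rw [injective_iff_map_eq_zero]
  intro t ht
  obtain ⟨c, rfl⟩ := TensorProduct.mk_surjective A M (IsLocalRing.ResidueField A)
    IsLocalRing.residue_surjective t
  have hfc : f c ∈ (IsLocalRing.maximalIdeal A • ⊤ : Submodule A N) := by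
    rw [← Submodule.Quotient.mk_eq_zero, ← TensorProduct.quotTensorEquivQuotSMul_mk_one_tmul]
    exact (congrArg _ ht).trans (map_zero _)
  have hsc : s • c = 0 := by
    apply hf
    rw [map_smul, map_zero]
    refine Submodule.smul_induction_on hfc (fun a ha n _ ↦ ?_) fun a b ha hb ↦ ?_
    · rw [smul_smul, hsm a ha, zero_smul]
    · rw [smul_add, ha, hb, add_zero]
  have hc : c ∈ (IsLocalRing.maximalIdeal A • ⊤ : Submodule A M) := by
    let b := Module.Free.chooseBasis A M
    rw [← b.sum_repr c]
    refine sum_mem fun i _ ↦ Submodule.smul_mem_smul ?_ trivial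
    intro hu
    apply hs
    rw [← hu.mul_left_eq_zero]
    simpa using DFunLike.congr_fun (congrArg b.repr hsc) i
  rw [← Submodule.Quotient.mk_eq_zero, ← TensorProduct.quotTensorEquivQuotSMul_mk_one_tmul,
    LinearEquiv.map_eq_zero_iff] at hc
  exact hc

theorem exists_ne_zero_forall_mem_maximalIdeal_mul_eq_zero {R : Type*} [CommRing R]
    [IsNoetherianRing R] [IsLocalRing R] {I : Ideal R}
    (hI : I.radical = IsLocalRing.maximalIdeal R) [IsLocalRing (R ⧸ I)] :
    ∃ s : R ⧸ I, s ≠ 0 ∧ ∀ a ∈ IsLocalRing.maximalIdeal (R ⧸ I), s * a = 0 := by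
  have hnil : ∀ a ∈ IsLocalRing.maximalIdeal (R ⧸ I), IsNilpotent a := by
    intro a ha
    obtain ⟨r, rfl⟩ := Ideal.Quotient.mk_surjective a
    have hr : r ∈ I.radical := by
      rw [hI]
      exact fun hu ↦ ha (hu.map _)
    obtain ⟨n, hn⟩ := hr
    exact ⟨n, by rw [← map_pow]; exact Ideal.Quotient.eq_zero_iff_mem.2 hn⟩
  obtain ⟨p, hp⟩ := associatedPrimes.nonempty (R ⧸ I) (R ⧸ I)
  obtain ⟨hprime, s, hs⟩ := isAssociatedPrime_iff.1 hp
  have hps : ∀ a, a ∈ p ↔ a * s = 0 := fun a ↦ by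
    rw [hs, Submodule.mem_colon_singleton, Submodule.mem_bot, smul_eq_mul]
  refine ⟨s, ?_, fun a ha ↦ ?_⟩
  · rintro rfl
    exact hprime.one_notMem ((hps 1).2 (mul_zero _))
  · obtain ⟨n, hn⟩ := hnil a ha
    rw [mul_comm, ← hps]
    exact hprime.mem_of_pow_mem n (hn ▸ zero_mem p)

theorem exists_sup_span_eq_of_free {R : Type*} [CommRing R] [IsNoetherianRing R] [IsLocalRing R]
    {d : ℕ} {I : Ideal R} (hI : I.radical = IsLocalRing.maximalIdeal R) {x : Fin d → R}
    (hxI : ∀ i, x i ∈ I) (hreg : IsQuasiRegularOn x Set.univ)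
    (hred : I ^ 2 = Ideal.span (Set.range x) * I)
    (hfree : Module.Free (R ⧸ I) (↥I ⧸ (I • ⊤ : Submodule R ↥I))) :
    ∃ (ι : Type) (_ : Fintype ι) (y : ι → R),
      Ideal.span (Set.range x) ⊔ Ideal.span (Set.range y) = I ∧
      ∀ b : ι → R, ∑ j, b j * y j ∈ Ideal.span (Set.range x) → ∀ j, b j ∈ I := by
  have hItop : I ≠ ⊤ := by
    rintro rfl
    exact (IsLocalRing.maximalIdeal.isMaximal R).ne_top (hI.symm.trans (Ideal.radical_top R))
  have : Nontrivial (R ⧸ I) := Ideal.Quotient.nontrivial_iff.2 hItop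
  have : IsLocalRing (R ⧸ I) := IsLocalRing.of_surjective' _ Ideal.Quotient.mk_surjective
  have : Module.Finite (R ⧸ I) (↥I ⧸ (I • ⊤ : Submodule R ↥I)) :=
    Module.Finite.of_restrictScalars_finite R _ _
  have mem_sq : ∀ z : I, z ∈ (I • ⊤ : Submodule R I) ↔ (z : R) ∈ I ^ 2 := by
    intro z
    rw [Submodule.mem_smul_top_iff, smul_eq_mul, sq]
  have hQI : Ideal.span (Set.range x) ≤ I := Ideal.span_le.2 (Set.range_subset_iff.2 hxI)
  let f : (Fin d → R ⧸ I) →ₗ[R ⧸ I] (↥I ⧸ (I • ⊤ : Submodule R ↥I)) :=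
    Fintype.linearCombination (R ⧸ I) fun i ↦ Submodule.Quotient.mk ⟨x i, hxI i⟩
  have hf : ∀ c : Fin d → R, f (fun i ↦ Ideal.Quotient.mk I (c i)) =
      Submodule.Quotient.mk (∑ i, c i • ⟨x i, hxI i⟩) := by
    intro c
    rw [← Submodule.mkQ_apply, map_sum]
    simp only [f, Fintype.linearCombination_apply, map_smul]
    rfl
  have hinj : Function.Injective f := by
    rw [injective_iff_map_eq_zero]
    intro c hc
    choose r hr using fun i ↦ Ideal.Quotient.mk_surjective (c i)
    obtain rfl : (fun i ↦ Ideal.Quotient.mk I (r i)) = c := funext hr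
    rw [hf, Submodule.Quotient.mk_eq_zero, mem_sq, hred] at hc
    have := hreg.mem_map_C_of_eval_mem (J := I) (n := 1) (F := ∑ i, C (r i) * X i)
      (by simpa using hQI)
      (IsHomogeneous.sum _ _ _ fun i _ ↦ by
        simpa using (isHomogeneous_C _ (r i)).mul (isHomogeneous_X R i))
      (by simp) (by simpa using hc)
    funext i
    have := MvPolynomial.mem_map_C_iff.1 this (Finsupp.single i 1)
    simp [coeff_sum, coeff_C_mul, coeff_X, Finsupp.single_left_inj] at this
    simpa using Ideal.Quotient.eq_zero_iff_mem.2 this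
  obtain ⟨s, hs, hsm⟩ := exists_ne_zero_forall_mem_maximalIdeal_mul_eq_zero hI
  have := Module.Free.quotient_range_of_injective hs hsm f hinj
  let π : I →ₗ[R] _ := (LinearMap.range f).mkQ.restrictScalars R ∘ₗ (I • ⊤ : Submodule R I).mkQ
  have hπ : Function.Surjective π :=
    (Submodule.mkQ_surjective _).comp (Submodule.mkQ_surjective _)
  have hker : ∀ z : I, π z = 0 ↔ (z : R) ∈ Ideal.span (Set.range x) := by
    intro z
    have : π z = 0 ↔ Submodule.Quotient.mk z ∈ LinearMap.range f :=
      Submodule.Quotient.mk_eq_zero _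
    rw [this, Ideal.mem_span_range_iff_exists_fun]
    constructor
    · rintro ⟨c, hc⟩
      choose r hr using fun i ↦ Ideal.Quotient.mk_surjective (c i)
      obtain rfl : (fun i ↦ Ideal.Quotient.mk I (r i)) = c := funext hr
      rw [hf, eq_comm, Submodule.Quotient.eq, mem_sq, hred] at hc
      have hmem : (∑ i, r i * x i) ∈ Ideal.span (Set.range x) :=
        Ideal.mem_span_range_iff_exists_fun.2 ⟨r, rfl⟩
      rw [← Ideal.mem_span_range_iff_exists_fun]
      simpa using add_mem (Ideal.mul_le_left hc) hmem
    · rintro ⟨c, hc⟩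
      refine ⟨fun i ↦ Ideal.Quotient.mk I (c i), ?_⟩
      rw [hf]
      congr 1
      exact Subtype.ext (by simpa using hc)
  let b := Module.finBasis (R ⧸ I) (_ ⧸ LinearMap.range f)
  choose y hy using fun j ↦ hπ (b j)
  have hsum : ∀ c : _ → R, π (∑ j, c j • y j) = ∑ j, Ideal.Quotient.mk I (c j) • b j := by
    intro c
    simp only [map_sum, map_smul, hy]
    exact Finset.sum_congr rfl fun j _ ↦ (algebraMap_smul (R ⧸ I) (c j) (b j)).symm
  refine ⟨_, inferInstance, fun j ↦ (y j : R), le_antisymm ?_ ?_, ?_⟩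
  · exact sup_le hQI (Ideal.span_le.2 (Set.range_subset_iff.2 fun j ↦ (y j).2))
  · intro z hz
    choose r hr using fun j ↦ Ideal.Quotient.mk_surjective (b.repr (π ⟨z, hz⟩) j)
    have hzero : π (⟨z, hz⟩ - ∑ j, r j • y j) = 0 := by
      rw [map_sub, hsum]
      simp only [hr, b.sum_repr, sub_self]
    rw [hker] at hzero
    refine Submodule.mem_sup.2 ⟨_, hzero, ∑ j, r j * (y j : R),
      Ideal.mem_span_range_iff_exists_fun.2 ⟨r, rfl⟩, by simp⟩
  · intro c hc j
    have hzero : π (∑ j, c j • y j) = 0 := (hker _).2 (by simpa using hc)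
    rw [hsum] at hzero
    exact Ideal.Quotient.eq_zero_iff_mem.1
      (Fintype.linearIndependent_iff.1 b.linearIndependent _ hzero j)


/-- Proposition 3.2 of the paper.
Let `(R, m)` be a commutative Noetherian local ring of Krull dimension
`d ≥ 1` and `I` an `m`-primary ideal.  Suppose `x₁, …, x_d ∈ I` form a
regular sequence on `R` such that, with `Q = (x₁, …, x_d)`, one has
`I² = Q·I`, and suppose `I/I²` is a free `R/I`-module.  Then `Iˡ/Iˡ⁺¹` is a
free `R/I`-module for every `l ≥ 1`. -/
theorem stmt6 {R : Type*} [CommRing R] [IsNoetherianRing R] [IsLocalRing R]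
    (d : ℕ) (hd : 1 ≤ d) (hdim : ringKrullDim R = d)
    (I : Ideal R) (hprim : I.radical = IsLocalRing.maximalIdeal R)
    (x : Fin d → R) (hxI : ∀ i, x i ∈ I)
    (hreg : RingTheory.Sequence.IsRegular R (List.ofFn x))
    (hred : I ^ 2 = Ideal.span (Set.range x) * I)
    (hfree : Module.Free (R ⧸ I) (↥I ⧸ (I • ⊤ : Submodule R ↥I))) :
    ∀ l : ℕ, 1 ≤ l →
      Module.Free (R ⧸ I) (↥(I ^ l) ⧸ (I • ⊤ : Submodule R ↥(I ^ l))) := by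
  intro l hl
  obtain ⟨n, rfl⟩ := Nat.exists_eq_add_of_le' hl
  clear hl hd hdim
  have hQR := hreg.toIsWeaklyRegular.isQuasiRegularOn
  obtain ⟨ι, _, y, hsup, hy⟩ := exists_sup_span_eq_of_free hprim hxI hQR hred hfree
  have mem_iff := fun n ↦ Ideal.mem_span_image_pow_mul_iff x Set.univ n
  simp only [Set.image_univ, supported_univ, Algebra.mem_top, true_and] at mem_iff
  have mem_map := fun (J : Ideal R) hJ n F ↦ hQR.mem_map_C_of_eval_mem (J := J) hJ (n := n) (F := F)
  simp only [Set.image_univ, supported_univ, Algebra.mem_top, true_imp_iff] at mem_map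
  set Q := Ideal.span (Set.range x) with hQ
  have hQI : Q ≤ I := le_sup_left.trans hsup.le
  have hyI : ∀ j, y j ∈ I := fun j ↦ hsup.le (le_sup_right (a := Q) (Ideal.subset_span ⟨j, rfl⟩))
  have hpow : ∀ n, I ^ (n + 1) = Q ^ n * I := by
    intro n
    induction n with
    | zero => simp
    | succ n ih => rw [pow_succ, ih, mul_assoc, ← sq, hred, pow_succ, mul_assoc]
  let g : (homogeneousSubmodule (Fin d) R (n + 1) × (ι → homogeneousSubmodule (Fin d) R n)) →ₗ[R]
      R := ((aeval x).toLinearMap ∘ₗ Submodule.subtype _).coprod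
        (∑ j, y j • ((aeval x).toLinearMap ∘ₗ Submodule.subtype _ ∘ₗ LinearMap.proj j))
  have hg : ∀ p, g p = eval x (p.1 : MvPolynomial (Fin d) R) +
      ∑ j, y j * eval x (p.2 j : MvPolynomial (Fin d) R) := by
    intro p
    simp [g, aeval_eq_eval]
  have mem_pow : ∀ n (F : homogeneousSubmodule (Fin d) R n),
      eval x (F : MvPolynomial (Fin d) R) ∈ Q ^ n := by
    intro n F
    rw [← Ideal.mul_top (Q ^ n), mem_iff]
    exact ⟨F, F.2, by simp [Ideal.map_top], rfl⟩
  have hgmem : ∀ p, g p ∈ I ^ (n + 1) := by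
    intro p
    rw [hg]
    refine add_mem (Ideal.pow_right_mono hQI _ (mem_pow _ _)) (sum_mem fun j _ ↦ ?_)
    rw [hpow, mul_comm (y j)]
    exact Ideal.mul_mem_mul (mem_pow _ _) (hyI j)
  refine Module.Free.quotient_smul_top_of_surjective I (g.codRestrict (I ^ (n + 1)) hgmem) ?_ ?_
  · rintro ⟨z, hz⟩
    have hz' := hz
    rw [hpow, ← hsup, Ideal.mul_sup, ← pow_succ] at hz'
    obtain ⟨u, hu, v, hv, rfl⟩ := Submodule.mem_sup.1 hz'
    have hv : ∃ q : ι → homogeneousSubmodule (Fin d) R n,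
        ∑ j, y j * eval x (q j : MvPolynomial (Fin d) R) = v := by
      refine Submodule.mul_induction_on hv ?_ ?_
      · intro a ha b hb
        rw [← Ideal.mul_top (Q ^ n), mem_iff] at ha
        obtain ⟨F, hF, -, rfl⟩ := ha
        obtain ⟨c, rfl⟩ := Ideal.mem_span_range_iff_exists_fun.1 hb
        refine ⟨fun j ↦ c j • ⟨F, hF⟩, ?_⟩
        simp only [Submodule.coe_smul, smul_eval, Finset.mul_sum]
        exact Finset.sum_congr rfl fun j _ ↦ by ring
      · rintro a b ⟨q, rfl⟩ ⟨q', rfl⟩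
        exact ⟨q + q', by simp [mul_add, Finset.sum_add_distrib]⟩
    obtain ⟨q, rfl⟩ := hv
    rw [← Ideal.mul_top (Q ^ (n + 1)), mem_iff] at hu
    obtain ⟨G, hG, -, rfl⟩ := hu
    exact ⟨(⟨G, hG⟩, q), Subtype.ext (hg _)⟩
  · classical
    rintro ⟨G, H⟩ hp
    have hp' : eval x (G : MvPolynomial (Fin d) R) +
        ∑ j, y j * eval x (H j : MvPolynomial (Fin d) R) ∈ Q ^ (n + 1) * I := by
      have := Submodule.mem_map_of_mem (f := (I ^ (n + 1)).subtype) hp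
      rw [Submodule.map_smul'', Submodule.map_top, Submodule.range_subtype] at this
      rw [← hpow, pow_succ', ← hg (G, H)]
      exact this
    have hsum : eval x (∑ j, C (y j) * (H j : MvPolynomial (Fin d) R)) =
      ∑ j, y j * eval x (H j : MvPolynomial (Fin d) R) := by simp
    have hhom : (∑ j, C (y j) * (H j : MvPolynomial (Fin d) R)).IsHomogeneous n :=
      IsHomogeneous.sum _ _ _ fun j _ ↦ by
        simpa using (isHomogeneous_C _ (y j)).mul (H j).2
    have hHQ := mem_map Q le_rfl n _ hhom (by
      rw [← pow_succ, hsum]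
      simpa using sub_mem ((Ideal.mul_le_left : Q ^ (n + 1) * I ≤ _) hp') (mem_pow _ G))
    have hHI : ∀ j, (H j : MvPolynomial (Fin d) R) ∈ I.map (C : R →+* MvPolynomial (Fin d) R) := by
      intro j
      rw [MvPolynomial.mem_map_C_iff] at hHQ ⊢
      intro m
      refine hy (fun j ↦ coeff m (H j : MvPolynomial (Fin d) R)) ?_ j
      simpa [coeff_sum, mul_comm (coeff m _)] using hHQ m
    have hGI : (G : MvPolynomial (Fin d) R) ∈ I.map (C : R →+* MvPolynomial (Fin d) R) := by
      refine mem_map I hQI _ _ G.2 ?_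
      rw [← Ideal.add_mem_iff_left _ (b := ∑ j, y j * eval x (H j : MvPolynomial (Fin d) R))]
      · exact hp'
      · refine sum_mem fun j _ ↦ ?_
        rw [pow_succ, mul_assoc, ← hred, sq, ← mul_assoc, mul_comm (y j)]
        refine Ideal.mul_mem_mul ?_ (hyI j)
        exact (mem_iff n I _).2 ⟨H j, (H j).2, hHI j, rfl⟩
    have hGH : (G, H) = LinearMap.inl R _ _ G +
        LinearMap.inr R _ _ (∑ j, LinearMap.single R _ j (H j)) := by
      simp [Finset.univ_sum_single]
    rw [hGH]
    refine add_mem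
      (Submodule.smul_top_le_comap_smul_top I _ (mem_smul_top_homogeneousSubmodule G hGI))
      (Submodule.smul_top_le_comap_smul_top I _ (sum_mem fun j _ ↦
        Submodule.smul_top_le_comap_smul_top I _ (mem_smul_top_homogeneousSubmodule (H j) (hHI j))))
end

section
/- Let (R, m) be a commutative Noetherian local ring of Krull dimension d ≥ 1, and let I be an m-primary ideal of R. Suppose there exist elements x₁, …, x_d ∈ I forming a regular sequence on R such that, with Q = (x₁, …, x_d), one has I² = QI, and suppose that I/I² is a free R/I-module. Then for every integer l ≥ 1 the R/I-module Q^{l-1}/I^l is free (with the convention Q^0 = R). -/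
/-- The quotient `Q^(l-1)/Iˡ` is annihilated by `I` (when `Q ≤ I` and `l ≥ 1`),
hence is an `R/I`-module. -/
noncomputable def quotPowModule {R : Type*} [CommRing R] (I Q : Ideal R) (hQI : Q ≤ I)
    (l : ℕ) (hl : 1 ≤ l) :
    Module (R ⧸ I) (↥(Q ^ (l - 1)) ⧸ Submodule.comap (Q ^ (l - 1)).subtype (I ^ l)) :=
  Module.IsTorsionBySet.module <| (Module.isTorsionBySet_quotient_iff _ _).mpr
    fun m r hr => by
      have h1 : (m : R) ∈ I ^ (l - 1) := Ideal.pow_right_mono hQI (l - 1) m.2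
      have h2 : r * (m : R) ∈ I ^ (l - 1 + 1) := by
        rw [pow_succ']; exact Ideal.mul_mem_mul hr h1
      rw [Nat.sub_add_cancel hl] at h2
      simpa [Submodule.mem_comap, Submodule.subtype_apply, smul_eq_mul] using h2

open MvPolynomial in
/-- The family `x` restricted to `s` is quasi-regular in degree `n`: every homogeneous relation of
degree `n` among the `x i`, `i ∈ s`, has all its coefficients in the ideal they generate. -/
def IsQuasiRegularInDegree {R σ : Type*} [CommRing R] (x : σ → R) (s : Set σ) (n : ℕ) : Prop :=
  ∀ F : MvPolynomial σ R, F.IsHomogeneous n → F ∈ supported R s → eval x F = 0 →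
    F ∈ (Ideal.span (x '' s)).map (C : R →+* MvPolynomial σ R)

section QuasiRegular

open MvPolynomial

variable {R σ : Type*} [CommRing R] {x : σ → R} {s : Set σ} {n : ℕ}

lemma prod_pow_mem_span_image_pow {m : σ →₀ ℕ} (hm : m.degree = n) (hs : ↑m.support ⊆ s) :
    ∏ i ∈ m.support, x i ^ m i ∈ Ideal.span (x '' s) ^ n := by
  rw [← hm, Finsupp.degree_apply, ← Finset.prod_pow_eq_pow_sum]
  exact Ideal.prod_mem_prod fun i hi =>
    Ideal.pow_mem_pow (Ideal.subset_span (Set.mem_image_of_mem x (hs hi))) _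

lemma eval_mem_mul_span_image_pow {J : Ideal R} {F : MvPolynomial σ R} (hF : F.IsHomogeneous n)
    (hs : F ∈ supported R s) (hJ : F ∈ J.map (C : R →+* MvPolynomial σ R)) :
    eval x F ∈ J * Ideal.span (x '' s) ^ n := by
  rw [eval_eq]
  refine sum_mem fun m hm => Ideal.mul_mem_mul (mem_map_C_iff.mp hJ m)
    (prod_pow_mem_span_image_pow (hF.degree_eq_sum_deg_support hm).symm fun i hi => ?_)
  exact mem_supported.mp hs ((mem_vars_iff_mem_support _).mpr ⟨m, hm, hi⟩)

lemma exists_isHomogeneous_of_mem_mul_span_image_pow {J : Ideal R} {y : R}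
    (hy : y ∈ J * Ideal.span (x '' s) ^ n) :
    ∃ F : MvPolynomial σ R, F.IsHomogeneous n ∧ F ∈ supported R s ∧
      F ∈ J.map (C : R →+* MvPolynomial σ R) ∧ eval x F = y := by
  induction hy using Submodule.mul_induction_on' with
  | mem_mul_mem r hr z hz =>
    rw [Set.image_eq_range, Ideal.mem_span_pow_iff_exists_isHomogeneous] at hz
    obtain ⟨p, hp, rfl⟩ := hz
    refine ⟨C r * rename (↑) p, (hp.rename_isHomogeneous).C_mul r, ?_,
      Ideal.mul_mem_right _ _ (Ideal.mem_map_of_mem _ hr), ?_⟩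
    · refine mul_mem ((supported R s).algebraMap_mem r) ?_
      rw [supported_eq_range_rename]
      exact ⟨p, rfl⟩
    · simp [eval_rename, Function.comp_def]
  | add y _ z _ hy hz =>
    obtain ⟨F, hF, hFs, hFJ, rfl⟩ := hy
    obtain ⟨G, hG, hGs, hGJ, rfl⟩ := hz
    exact ⟨F + G, hF.add hG, add_mem hFs hGs, add_mem hFJ hGJ, map_add _ _ _⟩

lemma IsQuasiRegularInDegree.mem_map_C_of_eval_mem (h : IsQuasiRegularInDegree x s n)
    {J : Ideal R} (hJ : Ideal.span (x '' s) ≤ J) {F : MvPolynomial σ R} (hF : F.IsHomogeneous n)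
    (hs : F ∈ supported R s) (hy : eval x F ∈ J * Ideal.span (x '' s) ^ n) :
    F ∈ J.map (C : R →+* MvPolynomial σ R) := by
  obtain ⟨G, hG, hGs, hGJ, hGF⟩ := exists_isHomogeneous_of_mem_mul_span_image_pow hy
  have := Ideal.map_mono hJ (h (F - G) (hF.sub hG) (sub_mem hs hGs) (by simp [hGF]))
  simpa using add_mem this hGJ

lemma IsQuasiRegularInDegree.mem_span_image_pow_of_mul_mem
    (h : ∀ n, IsQuasiRegularInDegree x s n) {a : R}
    (ha : ∀ y, a * y ∈ Ideal.span (x '' s) → y ∈ Ideal.span (x '' s)) (n : ℕ) {y : R}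
    (hy : a * y ∈ Ideal.span (x '' s) ^ n) : y ∈ Ideal.span (x '' s) ^ n := by
  induction n with
  | zero => simp
  | succ n ih =>
    have hyn := ih (Ideal.pow_le_pow_right n.le_succ hy)
    rw [← Ideal.top_mul (_ ^ n)] at hyn
    obtain ⟨G, hG, hGs, -, rfl⟩ := exists_isHomogeneous_of_mem_mul_span_image_pow hyn
    rw [pow_succ'] at hy ⊢
    refine eval_mem_mul_span_image_pow hG hGs (mem_map_C_iff.mpr fun m => ha _ ?_)
    have := (h n).mem_map_C_of_eval_mem le_rfl (hG.C_mul a)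
      (mul_mem ((supported R s).algebraMap_mem a) hGs) (by simpa using hy)
    simpa using mem_map_C_iff.mp this m

lemma isQuasiRegularInDegree_insert (h : ∀ n, IsQuasiRegularInDegree x s n) {i : σ}
    (hi : ∀ y, x i * y ∈ Ideal.span (x '' s) → y ∈ Ideal.span (x '' s)) (n : ℕ) :
    IsQuasiRegularInDegree x (insert i s) n := by
  have hle : Ideal.span (x '' s) ≤ Ideal.span (x '' insert i s) :=
    Ideal.span_mono (Set.image_mono (Set.subset_insert i s))
  induction n with
  | zero =>
    intro F hF _ h0
    rw [← totalDegree_zero_iff_isHomogeneous, totalDegree_eq_zero_iff_eq_C] at hF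
    rw [hF, eval_C] at h0
    rw [hF, h0, map_zero]
    exact zero_mem _
  | succ n ih =>
    intro F hF hFs h0
    set G := F.modMonomial (Finsupp.single i 1) with hGdef
    set H := F.divMonomial (Finsupp.single i 1) with hHdef
    have hFGH : X i * H + G = F := divMonomial_add_modMonomial_single F i
    have hcoeff {m : σ →₀ ℕ} (hm : coeff m G ≠ 0) : m i = 0 ∧ coeff m F ≠ 0 := by
      by_cases hle : Finsupp.single i 1 ≤ m
      · exact absurd (coeff_modMonomial_of_le F hle) hm
      · rw [hGdef, coeff_modMonomial_of_not_le F hle] at hm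
        refine ⟨?_, hm⟩
        simpa [Finsupp.single_le_iff] using hle
    have hG : G.IsHomogeneous (n + 1) := fun m hm => hF (hcoeff hm).2
    have hGs : G ∈ supported R s := by
      refine mem_supported.mpr fun j hj => ?_
      obtain ⟨m, hm, hjm⟩ := (mem_vars_iff_mem_support _).mp hj
      have hm' := hcoeff (mem_support_iff.mp hm)
      rcases mem_supported.mp hFs ((mem_vars_iff_mem_support _).mpr ⟨m, mem_support_iff.mpr hm'.2, hjm⟩) with
        rfl | hjs
      · exact absurd hm'.1 (Finsupp.mem_support_iff.mp hjm)
      · exact hjs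
    have hH : H.IsHomogeneous n := fun m hm => by
      rw [hHdef, coeff_divMonomial] at hm
      have := hF hm
      have hw (m : σ →₀ ℕ) : Finsupp.weight (1 : σ → ℕ) m = m.degree :=
        (DFunLike.congr_fun Finsupp.degree_eq_weight_one m).symm
      rw [hw, map_add, Finsupp.degree_single] at this
      rw [hw]
      omega
    have hHs : H ∈ supported R (insert i s) := by
      refine mem_supported.mpr fun j hj => ?_
      obtain ⟨m, hm, hjm⟩ := (mem_vars_iff_mem_support _).mp hj
      rw [mem_support_iff, hHdef, coeff_divMonomial] at hm
      refine mem_supported.mp hFs ((mem_vars_iff_mem_support _).mpr ⟨_, mem_support_iff.mpr hm, ?_⟩)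
      rw [Finsupp.mem_support_iff] at hjm ⊢
      rw [Finsupp.add_apply]
      omega
    have heval : x i * eval x H + eval x G = 0 := by
      rw [← h0, ← hFGH]; simp
    have hHmem : eval x H ∈ Ideal.span (x '' s) ^ (n + 1) := by
      refine IsQuasiRegularInDegree.mem_span_image_pow_of_mul_mem h hi (n + 1) ?_
      rw [eq_neg_of_add_eq_zero_left heval]
      refine neg_mem ?_
      rw [← Ideal.top_mul (_ ^ _)]
      exact eval_mem_mul_span_image_pow hG hGs (by simp [Ideal.map_top])
    have hHQ := ih.mem_map_C_of_eval_mem le_rfl hH hHs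
      (by rw [← pow_succ']; exact Ideal.pow_right_mono hle _ hHmem)
    rw [← Ideal.top_mul (_ ^ (n + 1))] at hHmem
    obtain ⟨K, hK, hKs, -, hKH⟩ := exists_isHomogeneous_of_mem_mul_span_image_pow hHmem
    have hGK := Ideal.map_mono hle <| h (n + 1) (G + C (x i) * K) (hG.add (hK.C_mul _))
      (add_mem hGs (mul_mem ((supported R s).algebraMap_mem _) hKs))
      (by rw [← heval]; simp [hKH, add_comm])
    have hxi : C (x i) ∈ (Ideal.span (x '' insert i s)).map (C : R →+* MvPolynomial σ R) :=
      Ideal.mem_map_of_mem _ (Ideal.subset_span ⟨i, Set.mem_insert i s, rfl⟩)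
    rw [← hFGH]
    exact add_mem (Ideal.mul_mem_left _ _ hHQ)
      ((add_mem_cancel_right (Ideal.mul_mem_right _ _ hxi)).mp hGK)

end QuasiRegular

lemma RingTheory.Sequence.IsWeaklyRegular.isQuasiRegularInDegree {R : Type*} [CommRing R] {d : ℕ}
    {x : Fin d → R} (hx : RingTheory.Sequence.IsWeaklyRegular R (List.ofFn x)) (n : ℕ) :
    IsQuasiRegularInDegree x Set.univ n := by
  suffices ∀ k ≤ d, ∀ n, IsQuasiRegularInDegree x {i | i.val < k} n by
    convert this d le_rfl n
    ext i
    simp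
  intro k
  induction k with
  | zero =>
    intro _ n F _ hs h0
    simp only [not_lt_zero, Set.ofPred_false, MvPolynomial.supported_empty] at hs
    obtain ⟨c, rfl⟩ := Algebra.mem_bot.mp hs
    simp only [MvPolynomial.algebraMap_eq, MvPolynomial.eval_C] at h0
    simp [h0]
  | succ k ih =>
    intro hk n
    have hset : {i : Fin d | i.val < k + 1} = insert ⟨k, hk⟩ {i | i.val < k} := by
      ext i
      simp [Fin.ext_iff]
      omega
    rw [hset]
    refine isQuasiRegularInDegree_insert (ih (by omega)) (fun y hy => ?_) n
    have hreg := hx.regular_mod_prev k (by simpa using hk)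
    have hspan : Ideal.ofList ((List.ofFn x).take k) • (⊤ : Submodule R R) =
        Ideal.span (x '' {i | i.val < k}) := by
      rw [smul_eq_mul, Ideal.mul_top, Ideal.ofList]
      congr 1
      ext r
      simp only [List.mem_take_iff_getElem, Set.mem_ofPred_eq, Set.mem_image]
      constructor
      · rintro ⟨i, hi, rfl⟩
        simp only [List.length_ofFn] at hi
        exact ⟨⟨i, by omega⟩, by simp; omega, by simp⟩
      · rintro ⟨i, hi, rfl⟩
        exact ⟨i, by simpa using hi, by simp⟩
    rw [hspan, isSMulRegular_quotient_iff_mem_of_smul_mem] at hreg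
    exact hreg y (by simpa using hy)

section Free

open MvPolynomial

variable {R σ : Type*} [CommRing R]

lemma pow_eq_mul_span_pow {I Q : Ideal R} (h : I ^ 2 = Q * I) {l : ℕ} (hl : 1 ≤ l) :
    I ^ l = I * Q ^ (l - 1) := by
  induction l, hl using Nat.le_induction with
  | base => simp
  | succ l hl ih =>
    obtain ⟨n, rfl⟩ := Nat.exists_eq_add_of_le' hl
    rw [pow_succ', ih, ← mul_assoc, ← sq, h]
    simp only [Nat.add_sub_cancel]
    ring

theorem free_quotPowModule {I : Ideal R} {x : σ → R} {l : ℕ} (hl : 1 ≤ l)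
    (hQI : Ideal.span (Set.range x) ≤ I)
    (hqr : IsQuasiRegularInDegree x Set.univ (l - 1))
    (hpow : I ^ l = I * Ideal.span (Set.range x) ^ (l - 1)) :
    letI := quotPowModule I (Ideal.span (Set.range x)) hQI l hl
    Module.Free (R ⧸ I) (↥(Ideal.span (Set.range x) ^ (l - 1)) ⧸
      Submodule.comap (Ideal.span (Set.range x) ^ (l - 1)).subtype (I ^ l)) := by
  set Q := Ideal.span (Set.range x)
  have hQ' : Ideal.span (x '' Set.univ) = Q := by rw [Set.image_univ]
  set N := Submodule.comap (Q ^ (l - 1)).subtype (I ^ l)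
  let _ : Module (R ⧸ I) (↥(Q ^ (l - 1)) ⧸ N) := quotPowModule I Q hQI l hl
  have hsmul (r : R) (y : ↥(Q ^ (l - 1)) ⧸ N) : Ideal.Quotient.mk I r • y = r • y := rfl
  let v : {m : σ →₀ ℕ // m.degree = l - 1} → ↥(Q ^ (l - 1)) := fun m =>
    ⟨∏ i ∈ m.1.support, x i ^ m.1 i,
      hQ' ▸ prod_pow_mem_span_image_pow m.2 (Set.subset_univ _)⟩
  refine Module.Free.of_basis (Module.Basis.mk (v := fun m => N.mkQ (v m)) ?_ ?_)
  · rw [linearIndependent_iff']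
    intro t g hg m hm
    choose r hr using fun m => Ideal.Quotient.mk_surjective (I := I) (g m)
    let F : MvPolynomial σ R := ∑ m ∈ t, monomial m.1 (r m)
    have hF : F.IsHomogeneous (l - 1) :=
      IsHomogeneous.sum _ _ _ fun m _ => isHomogeneous_monomial _ m.2
    have hmem : ∑ m ∈ t, r m • v m ∈ N := by
      rw [← Submodule.Quotient.mk_eq_zero, ← Submodule.mkQ_apply, map_sum, ← hg]
      refine Finset.sum_congr rfl fun m _ => ?_
      rw [← hr, hsmul, map_smul]
    have heval : eval x F ∈ I * Ideal.span (x '' Set.univ) ^ (l - 1) := by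
      rw [hQ', ← hpow]
      convert Submodule.mem_comap.mp hmem
      simp [F, v, eval_monomial, Finsupp.prod]
    have hcoeff := mem_map_C_iff.mp (hqr.mem_map_C_of_eval_mem (hQ'.trans_le hQI) hF
      (by simp) heval) m.1
    rw [← hr, Ideal.Quotient.eq_zero_iff_mem]
    classical
    simpa [F, coeff_sum, coeff_monomial, Subtype.ext_iff.symm, hm] using hcoeff
  · rintro y -
    obtain ⟨⟨y, hy⟩, rfl⟩ := N.mkQ_surjective y
    obtain ⟨F, hF, rfl⟩ := (Ideal.mem_span_pow_iff_exists_isHomogeneous x y).mp hy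
    have hFv : (⟨eval x F, hy⟩ : ↥(Q ^ (l - 1))) = ∑ m ∈ F.support.attach,
        coeff m.1 F • v ⟨m.1, (hF.degree_eq_sum_deg_support m.2).symm⟩ := by
      ext
      simp only [eval_eq, v, AddSubmonoidClass.coe_finset_sum, SetLike.val_smul, smul_eq_mul]
      exact (Finset.sum_attach F.support fun m => coeff m F * ∏ i ∈ m.support, x i ^ m i).symm
    rw [hFv, map_sum]
    refine sum_mem fun m _ => ?_
    rw [map_smul, ← hsmul]
    exact Submodule.smul_mem _ _ (Submodule.subset_span (Set.mem_range_self _))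

end Free

/-- an intermediate claim in the proof of Proposition 3.2 of
the paper.  Let `(R, m)` be a commutative Noetherian local ring of Krull
dimension `d ≥ 1` and `I` an `m`-primary ideal.  Suppose `x₁, …, x_d ∈ I`
form a regular sequence on `R` such that, with `Q = (x₁, …, x_d)`, one has
`I² = Q·I`, and suppose `I/I²` is a free `R/I`-module.  Then `Q^(l-1)/Iˡ`
is a free `R/I`-module for every `l ≥ 1` (with the convention `Q⁰ = R`). -/
theorem stmt7 {R : Type*} [CommRing R] [IsNoetherianRing R] [IsLocalRing R]
    (d : ℕ) (hd : 1 ≤ d) (hdim : ringKrullDim R = d)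
    (I : Ideal R) (hprim : I.radical = IsLocalRing.maximalIdeal R)
    (x : Fin d → R) (hxI : ∀ i, x i ∈ I)
    (hreg : RingTheory.Sequence.IsRegular R (List.ofFn x))
    (hred : I ^ 2 = Ideal.span (Set.range x) * I)
    (hfree : Module.Free (R ⧸ I) (↥I ⧸ (I • ⊤ : Submodule R ↥I))) :
    ∀ l : ℕ, (hl : 1 ≤ l) →
      @Module.Free (R ⧸ I)
        (↥(Ideal.span (Set.range x) ^ (l - 1)) ⧸
          Submodule.comap (Ideal.span (Set.range x) ^ (l - 1)).subtype (I ^ l))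
        _ _
        (quotPowModule I (Ideal.span (Set.range x))
          (Ideal.span_le.mpr (Set.range_subset_iff.mpr hxI)) l hl) := by
  intro l hl
  exact free_quotPowModule hl _ (hreg.toIsWeaklyRegular.isQuasiRegularInDegree _)
    (pow_eq_mul_span_pow hred hl)
end

section
/- Let (R, m) be a commutative local ring and let I be an ideal of R. Suppose there exist an integer l ≥ 1 and a nonzerodivisor y ∈ R with I^l = (y), and suppose there exist t ∈ R and an integer N such that I^{m+1} = tI^m for all m ≥ N. Then I = (t) and t is a nonzerodivisor of R; in particular I is a principal ideal generated by a nonzerodivisor. -/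
/-- Multiplication by the principal ideal of a left-regular element is cancellative on ideals. -/
theorem Ideal.eq_of_mul_span_singleton_eq_of_isLeftRegular {R : Type*} [CommRing R]
    {I J : Ideal R} {z : R} (hz : IsLeftRegular z)
    (h : I * Ideal.span {z} = J * Ideal.span {z}) : I = J := by
  ext x
  have key (K : Ideal R) : x ∈ K ↔ z * x ∈ K * Ideal.span {z} := by
    rw [mul_comm K, Ideal.mem_span_singleton_mul]
    refine ⟨fun hx => ⟨x, hx, rfl⟩, ?_⟩
    rintro ⟨w, hw, hwx⟩
    exact hz hwx ▸ hw
  rw [key I, key J, h]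

/-- the dimension-one case of (d) ⇒ (b) in Theorem 1.2 of
the paper.  Let `(R, m)` be a commutative local ring and `I` an ideal.
Suppose `Iˡ = (y)` for some `l ≥ 1` and a nonzerodivisor `y`, and suppose
there are `t ∈ R` and `N` with `Iᵐ⁺¹ = t·Iᵐ` for all `m ≥ N`.  Then
`I = (t)` and `t` is a nonzerodivisor; in particular `I` is principal,
generated by a nonzerodivisor. -/
theorem stmt10 {R : Type*} [CommRing R] [IsLocalRing R] (I : Ideal R)
    (l : ℕ) (hl : 1 ≤ l) (y : R) (hy : Function.Injective fun r : R => y * r)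
    (hyI : I ^ l = Ideal.span {y})
    (t : R) (N : ℕ) (ht : ∀ m : ℕ, N ≤ m → I ^ (m + 1) = Ideal.span {t} * I ^ m) :
    I = Ideal.span {t} ∧ Function.Injective fun r : R => t * r := by
  have hyreg : IsLeftRegular y := hy
  have hpow : I ^ (l * N) = Ideal.span {y ^ N} := by
    rw [pow_mul, hyI, Ideal.span_singleton_pow]
  have hI : I = Ideal.span {t} := by
    refine Ideal.eq_of_mul_span_singleton_eq_of_isLeftRegular (hyreg.pow N) ?_
    rw [← hpow, ← pow_succ', ht _ (Nat.le_mul_of_pos_left N hl)]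
  refine ⟨hI, ?_⟩
  have hdvd : t ∣ y := by
    have hy_mem : y ∈ I ^ l := hyI ▸ Ideal.mem_span_singleton_self y
    exact Ideal.mem_span_singleton.mp (hI ▸ Ideal.pow_le_self (by lia) hy_mem)
  obtain ⟨c, rfl⟩ := hdvd
  exact IsLeftRegular.of_mul (a := c) (mul_comm t c ▸ hyreg)
end
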